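/- arXiv:2405.20586 — 3 statements merged into one kernel-verified Lean document; each statement's English description precedes it below -/
import Mathlib

section
/- For a multipartite quantum state ensemble E = {(η_i, ρ_i)}_{i=1}^n and each j ∈ {1,...,n}, one has S_j(E) ≤ Q_j(E), where S_j(E) is the maximum confidence to identify ρ_j achievable by separable measurements and Q_j(E) = min{ q ∈ ℝ : qρ_0 − η_j ρ_j is block positive }. -/
open ComplexOrder

/-- The product operator `σ 1 ⊗ ⋯ ⊗ σ m` on the multipartite space
`⨂ k, ℂ^(d k)`, realized as a matrix indexed by tuples. -/
noncomputable def prodMat {m : ℕ} (d : Fin m → ℕ)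
    (σ : ∀ k : Fin m, Matrix (Fin (d k)) (Fin (d k)) ℂ) :
    Matrix (∀ k, Fin (d k)) (∀ k, Fin (d k)) ℂ :=
  Matrix.of fun x y => ∏ k, σ k (x k) (y k)

/-- A density matrix: positive semidefinite with unit trace. -/
def IsState {ι : Type*} [Fintype ι] (ρ : Matrix ι ι ℂ) : Prop :=
  ρ.PosSemidef ∧ ρ.trace = 1

/-- A separable operator: a conic combination of product states. -/
def IsSep {m : ℕ} {d : Fin m → ℕ}
    (E : Matrix (∀ k, Fin (d k)) (∀ k, Fin (d k)) ℂ) : Prop :=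
  ∃ (L : ℕ) (p : Fin L → ℝ)
    (σ : Fin L → ∀ k : Fin m, Matrix (Fin (d k)) (Fin (d k)) ℂ),
    (∀ l, 0 ≤ p l) ∧ (∀ l k, IsState (σ l k)) ∧
    E = ∑ l, (p l : ℂ) • prodMat d (σ l)

/-- A block-positive Hermitian operator: `Tr (E * F) ≥ 0` for every separable `F`. -/
def IsBlockPos {m : ℕ} {d : Fin m → ℕ}
    (E : Matrix (∀ k, Fin (d k)) (∀ k, Fin (d k)) ℂ) : Prop :=
  E.IsHermitian ∧ ∀ F, IsSep F → 0 ≤ (E * F).trace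

open scoped MatrixOrder in
/-- A positive semidefinite matrix factors as `Bᴴ * B`. -/
theorem exists_eq_conjTranspose_mul_self {ι : Type*} [Fintype ι] {A : Matrix ι ι ℂ}
    (hA : A.PosSemidef) : ∃ B : Matrix ι ι ℂ, A = B.conjTranspose * B := by
  classical
  exact CStarAlgebra.nonneg_iff_eq_star_mul_self.mp hA.nonneg

/-- The product operator of positive semidefinite matrices is positive semidefinite. -/
theorem posSemidef_prodMat {m : ℕ} {d : Fin m → ℕ}
    {σ : ∀ k : Fin m, Matrix (Fin (d k)) (Fin (d k)) ℂ} (hσ : ∀ k, (σ k).PosSemidef) :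
    (prodMat d σ).PosSemidef := by
  choose B hB using fun k => exists_eq_conjTranspose_mul_self (hσ k)
  have h : prodMat d σ = (prodMat d B).conjTranspose * prodMat d B := by
    ext x y
    simp [prodMat, hB, Matrix.mul_apply, Finset.prod_univ_sum, Finset.prod_mul_distrib]
  rw [h]
  exact Matrix.posSemidef_conjTranspose_mul_self _

/-- Separable operators are positive semidefinite. -/
theorem IsSep.posSemidef {m : ℕ} {d : Fin m → ℕ}
    {E : Matrix (∀ k, Fin (d k)) (∀ k, Fin (d k)) ℂ} (hE : IsSep E) : E.PosSemidef := by
  obtain ⟨L, p, σ, hp, hσ, rfl⟩ := hE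
  exact Matrix.posSemidef_sum _ fun l _ =>
    (posSemidef_prodMat fun k => (hσ l k).1).smul (by exact_mod_cast hp l)

/-- The trace of a product of two positive semidefinite matrices is nonnegative. -/
theorem trace_mul_nonneg_of_posSemidef {ι : Type*} [Fintype ι] {A B : Matrix ι ι ℂ}
    (hA : A.PosSemidef) (hB : B.PosSemidef) : 0 ≤ (A * B).trace := by
  obtain ⟨C, rfl⟩ := exists_eq_conjTranspose_mul_self hA
  rw [Matrix.mul_assoc, Matrix.trace_mul_comm]
  exact (hB.mul_mul_conjTranspose_same C).trace_nonneg

/-- the maximum confidence `S j` achievable by separable measurements is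
bounded above by `Q j = min {q | q • ρ₀ - η j • ρ j is block positive}`. -/
theorem maxConfidence_sep_le_Q
    {m : ℕ} (hm : 2 ≤ m) {d : Fin m → ℕ} (hd : ∀ k, 0 < d k) {n : ℕ}
    (η : Fin n → ℝ) (ρ : Fin n → Matrix (∀ k, Fin (d k)) (∀ k, Fin (d k)) ℂ)
    (hηpos : ∀ i, 0 < η i) (hηsum : ∑ i, η i = 1) (hρ : ∀ i, IsState (ρ i))
    (j : Fin n) (ρ₀ : Matrix (∀ k, Fin (d k)) (∀ k, Fin (d k)) ℂ)
    (hρ₀ : ρ₀ = ∑ i, (η i : ℂ) • ρ i) (s q : ℝ)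
    (hS : IsGreatest {x : ℝ |
        ∃ M : Fin (n + 1) → Matrix (∀ k, Fin (d k)) (∀ k, Fin (d k)) ℂ,
          (∀ i, IsSep (M i)) ∧ (∑ i, M i = 1) ∧ (ρ₀ * M j.succ).trace ≠ 0 ∧
          x = η j * ((ρ j * M j.succ).trace.re) / ((ρ₀ * M j.succ).trace.re)} s)
    (hQ : IsLeast {t : ℝ | IsBlockPos ((t : ℂ) • ρ₀ - (η j : ℂ) • ρ j)} q) :
    s ≤ q := by
  obtain ⟨M, hM, -, hne, rfl⟩ := hS.1
  have hρ₀psd : ρ₀.PosSemidef := by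
    rw [hρ₀]
    exact Matrix.posSemidef_sum _ fun i _ => (hρ i).1.smul (by exact_mod_cast (hηpos i).le)
  have hpos : 0 < (ρ₀ * M j.succ).trace.re :=
    (Complex.lt_def.mp ((trace_mul_nonneg_of_posSemidef hρ₀psd (hM j.succ).posSemidef).lt_of_ne
      hne.symm)).1
  have hblock := (Complex.le_def.mp (hQ.1.2 (M j.succ) (hM j.succ))).1
  rw [div_le_iff₀ hpos]
  simpa [sub_mul, Matrix.trace_sub] using hblock
end

section
/- Let W be an entanglement witness on a multipartite Hilbert space, with Jordan decomposition W = W_+ − W_− where W_+ and W_− are positive-semidefinite operators with orthogonal supports (so Tr W_− > 0 and Tr W_+ > 0). Define the two-state ensemble E = {(η_1, ρ_1), (η_2, ρ_2)} by η_1 = Tr W_−/(Tr W_+ + Tr W_−), ρ_1 = W_−/Tr W_−, η_2 = Tr W_+/(Tr W_+ + Tr W_−), ρ_2 = W_+/Tr W_+. Then Q_1(E) ≤ 1/2 < C_1(E); in particular, the maximum confidence to identify ρ_1 is not achievable by separable measurements. -/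
open ComplexOrder

/-- A nonnegative real multiple of a block-positive operator is block positive. -/
theorem IsBlockPos.smul {m : ℕ} {d : Fin m → ℕ}
    {E : Matrix (∀ k, Fin (d k)) (∀ k, Fin (d k)) ℂ} (hE : IsBlockPos E) {c : ℝ} (hc : 0 ≤ c) :
    IsBlockPos ((c : ℂ) • E) := by
  have hc' : (0 : ℂ) ≤ (c : ℂ) := by exact_mod_cast hc
  refine ⟨?_, fun F hF => ?_⟩
  · rw [Matrix.IsHermitian, Matrix.conjTranspose_smul, hE.1.eq]
    simp
  · rw [Matrix.smul_mul, Matrix.trace_smul, smul_eq_mul]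
    exact mul_nonneg hc' (hE.2 F hF)

/-- The trace of a positive semidefinite matrix is its real part. -/
theorem Matrix.PosSemidef.ofReal_re_trace {ι : Type*} [Fintype ι] {A : Matrix ι ι ℂ}
    (hA : A.PosSemidef) : ((A.trace.re : ℝ) : ℂ) = A.trace :=
  (Complex.eq_re_of_ofReal_le (r := 0) (by simpa using hA.trace_nonneg)).symm

/-- Normalizing a positive semidefinite matrix and weighting it with its share of the total
trace `T` divides it by `T`; this includes the zero matrix. -/
theorem Matrix.PosSemidef.weighted_normalize {ι : Type*} [Fintype ι] {A : Matrix ι ι ℂ}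
    (hA : A.PosSemidef) (T : ℝ) :
    ((A.trace.re / T : ℝ) : ℂ) • (A.trace)⁻¹ • A = ((T⁻¹ : ℝ) : ℂ) • A := by
  by_cases h : A.trace = 0
  · simp [hA.trace_eq_zero_iff.mp h]
  · rw [smul_smul, Complex.ofReal_div, hA.ofReal_re_trace, Complex.ofReal_inv]
    congr 1
    field_simp

/-- for the two-state ensemble built from the Jordan decomposition
`W = W₊ - W₋` of an entanglement witness `W`, we have `Q 1 ≤ 1/2 < C 1`; in particular
the maximum confidence to identify `ρ₁` is not achievable by separable measurements. -/
theorem ensemble_from_EW_nonlocal_confidence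
    {m : ℕ} (hm : 2 ≤ m) {d : Fin m → ℕ} (hd : ∀ k, 0 < d k)
    (W Wp Wm : Matrix (∀ k, Fin (d k)) (∀ k, Fin (d k)) ℂ)
    (hEW : IsBlockPos W ∧ ¬ W.PosSemidef)
    (hWp : Wp.PosSemidef) (hWm : Wm.PosSemidef)
    (hJordan : W = Wp - Wm) (horth : Wp * Wm = 0)
    (η₁ η₂ : ℝ) (ρ₁ ρ₂ ρ₀ : Matrix (∀ k, Fin (d k)) (∀ k, Fin (d k)) ℂ)
    (hη₁ : η₁ = Wm.trace.re / (Wp.trace.re + Wm.trace.re))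
    (hη₂ : η₂ = Wp.trace.re / (Wp.trace.re + Wm.trace.re))
    (hρ₁ : ρ₁ = (Wm.trace)⁻¹ • Wm)
    (hρ₂ : ρ₂ = (Wp.trace)⁻¹ • Wp)
    (hρ₀ : ρ₀ = (η₁ : ℂ) • ρ₁ + (η₂ : ℂ) • ρ₂)
    (Q C : ℝ)
    (hQ : IsLeast {t : ℝ | IsBlockPos ((t : ℂ) • ρ₀ - (η₁ : ℂ) • ρ₁)} Q)
    (hC : IsLeast {t : ℝ | ((t : ℂ) • ρ₀ - (η₁ : ℂ) • ρ₁).PosSemidef} C) :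
    Q ≤ 1 / 2 ∧ 1 / 2 < C := by
  have hT : 0 < Wp.trace.re + Wm.trace.re := by
    have hp : 0 ≤ Wp.trace.re := (Complex.nonneg_iff.mp hWp.trace_nonneg).1
    have hm' : 0 ≤ Wm.trace.re := (Complex.nonneg_iff.mp hWm.trace_nonneg).1
    have hne : Wm.trace.re ≠ 0 := fun h => hEW.2 <| by
      have h0 : Wm = 0 := by
        rw [← hWm.trace_eq_zero_iff, ← hWm.ofReal_re_trace, h, Complex.ofReal_zero]
      rw [hJordan, h0, sub_zero]
      exact hWp
    have := lt_of_le_of_ne hm' hne.symm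
    linarith
  have h₁ : (η₁ : ℂ) • ρ₁ = (((Wp.trace.re + Wm.trace.re)⁻¹ : ℝ) : ℂ) • Wm := by
    rw [hη₁, hρ₁, hWm.weighted_normalize]
  have h₂ : (η₂ : ℂ) • ρ₂ = (((Wp.trace.re + Wm.trace.re)⁻¹ : ℝ) : ℂ) • Wp := by
    rw [hη₂, hρ₂, hWp.weighted_normalize]
  rw [h₁, h₂] at hρ₀
  rw [h₁] at hQ hC
  generalize Wp.trace.re + Wm.trace.re = T at *
  have hρ₀_psd : ρ₀.PosSemidef := by
    have hT' : (0 : ℂ) ≤ ((T⁻¹ : ℝ) : ℂ) := by exact_mod_cast (inv_pos.mpr hT).le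
    rw [hρ₀]
    exact (hWm.smul hT').add (hWp.smul hT')
  have half : ((1 / 2 : ℝ) : ℂ) • ρ₀ - ((T⁻¹ : ℝ) : ℂ) • Wm = ((T⁻¹ / 2 : ℝ) : ℂ) • W := by
    rw [hρ₀, hJordan]
    push_cast
    module
  refine ⟨hQ.2 ?_, ?_⟩
  · rw [Set.mem_ofPred_eq, half]
    exact hEW.1.smul (by positivity)
  · by_contra! hC_le
    apply hEW.2
    have hC_diff : (0 : ℂ) ≤ ((1 / 2 - C : ℝ) : ℂ) := by exact_mod_cast sub_nonneg.mpr hC_le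
    have hscale : (0 : ℂ) ≤ ((2 * T : ℝ) : ℂ) := by exact_mod_cast (by positivity : 0 ≤ 2 * T)
    have hW : W = ((2 * T : ℝ) : ℂ) • (((C : ℂ) • ρ₀ - ((T⁻¹ : ℝ) : ℂ) • Wm)
        + ((1 / 2 - C : ℝ) : ℂ) • ρ₀) := by
      have hsplit : ((C : ℂ) • ρ₀ - ((T⁻¹ : ℝ) : ℂ) • Wm) + ((1 / 2 - C : ℝ) : ℂ) • ρ₀
          = ((1 / 2 : ℝ) : ℂ) • ρ₀ - ((T⁻¹ : ℝ) : ℂ) • Wm := by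
        push_cast
        module
      rw [hsplit, half, smul_smul, ← Complex.ofReal_mul,
        show 2 * T * (T⁻¹ / 2) = 1 by field_simp, Complex.ofReal_one, one_smul]
    rw [hW]
    exact (hC.1.add (hρ₀_psd.smul hC_diff)).smul hscale
end

section
/- For a multipartite quantum state ensemble E = {(η_i, ρ_i)}_{i=1}^n and each j ∈ {1,...,n}: p_SEP(E) = η_j < p_G(E) if and only if η_j ρ_j − η_i ρ_i is block positive for every i = 1,...,n and at least one operator in {η_j ρ_j − η_i ρ_i}_{i=1}^n is an entanglement witness (block positive but not positive semidefinite). -/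
open ComplexOrder

open Matrix

section PosSemidef

variable {ι : Type*} [Fintype ι]

theorem Matrix.IsHermitian.im_trace_mul {A B : Matrix ι ι ℂ} (hA : A.IsHermitian)
    (hB : B.IsHermitian) : (A * B).trace.im = 0 := by
  have h : star (A * B).trace = (A * B).trace := by
    rw [← trace_conjTranspose, conjTranspose_mul, hA.eq, hB.eq, trace_mul_comm]
  exact Complex.conj_eq_iff_im.mp h

variable [DecidableEq ι]

theorem Matrix.PosSemidef.trace_mul_nonneg {A B : Matrix ι ι ℂ} (hA : A.PosSemidef)
    (hB : B.PosSemidef) : 0 ≤ (A * B).trace := by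
  open scoped MatrixOrder in
  obtain ⟨C, rfl⟩ := CStarAlgebra.nonneg_iff_eq_star_mul_self.mp hA.nonneg
  rw [star_eq_conjTranspose, trace_mul_cycle, trace_mul_cycle]
  exact (hB.mul_mul_conjTranspose_same C).trace_nonneg

theorem Matrix.PosSemidef.one_sub {A : Matrix ι ι ℂ} (hA : A.PosSemidef) (htr : A.trace = 1) :
    (1 - A).PosSemidef := by
  have hle (i : ι) : hA.1.eigenvalues i ≤ 1 := by
    have hsum : ∑ i, hA.1.eigenvalues i = 1 := by
      have h := hA.1.trace_eq_sum_eigenvalues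
      rw [htr] at h
      simpa using congrArg Complex.re h.symm
    rw [← hsum]
    exact Finset.single_le_sum (fun k _ => hA.eigenvalues_nonneg k) (Finset.mem_univ i)
  have hdiag : (1 - diagonal (fun i => (hA.1.eigenvalues i : ℂ)) : Matrix ι ι ℂ).PosSemidef := by
    rw [← diagonal_one, diagonal_sub, posSemidef_diagonal_iff]
    intro i
    rw [sub_nonneg]
    exact_mod_cast hle i
  have heq : 1 - A = Unitary.conjStarAlgAut ℂ _ hA.1.eigenvectorUnitary
      (1 - diagonal (fun i => (hA.1.eigenvalues i : ℂ))) := by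
    rw [map_sub, map_one]
    exact congrArg (1 - ·) hA.1.spectral_theorem
  rw [heq, Unitary.conjStarAlgAut_apply]
  exact hdiag.mul_mul_conjTranspose_same _

theorem exists_isState_trace_mul_neg {A : Matrix ι ι ℂ} (hA : A.IsHermitian)
    (hneg : ¬ A.PosSemidef) : ∃ P : Matrix ι ι ℂ, IsState P ∧ (A * P).trace.re < 0 := by
  rw [posSemidef_iff_dotProduct_mulVec] at hneg
  push Not at hneg
  obtain ⟨x, hx⟩ := hneg hA
  have hQ := posSemidef_vecMulVec_self_star x
  set Q := vecMulVec x (star x) with hQdef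
  have htr : (A * Q).trace = star x ⬝ᵥ A *ᵥ x := by
    rw [hQdef, mul_vecMulVec, trace_vecMulVec, dotProduct_comm]
  have hre : (A * Q).trace.re < 0 := by
    by_contra! h
    refine hx ?_
    rw [← htr, Complex.le_def]
    exact ⟨h, (hA.im_trace_mul hQ.1).symm⟩
  have hQ0 : 0 < Q.trace := lt_of_le_of_ne hQ.trace_nonneg fun h => by
    rw [hQ.trace_eq_zero_iff.mp h.symm] at hre
    simp at hre
  obtain ⟨hpos, him⟩ := Complex.lt_def.mp hQ0
  have hcast : (Q.trace.re : ℂ) = Q.trace := Complex.ext rfl him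
  refine ⟨((Q.trace.re⁻¹ : ℝ) : ℂ) • Q, ⟨hQ.smul ?_, ?_⟩, ?_⟩
  · exact_mod_cast (inv_pos.mpr hpos).le
  · rw [trace_smul, smul_eq_mul, Complex.ofReal_inv, hcast, inv_mul_cancel₀ hQ0.ne']
  · rw [Matrix.mul_smul, trace_smul, smul_eq_mul, Complex.re_ofReal_mul]
    exact mul_neg_of_pos_of_neg (inv_pos.mpr hpos) hre

end PosSemidef

section Separable

variable {m : ℕ} {d : Fin m → ℕ}

theorem prodMat_one : prodMat d (fun _ => 1) = 1 := by
  ext x y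
  simp only [prodMat, of_apply, one_apply]
  split_ifs with h
  · simp [h]
  · obtain ⟨k, hk⟩ := Function.ne_iff.mp h
    exact Finset.prod_eq_zero (Finset.mem_univ k) (if_neg hk)

theorem prodMat_add (A B : ∀ k, Matrix (Fin (d k)) (Fin (d k)) ℂ) :
    prodMat d (A + B) = ∑ s : Finset (Fin m), prodMat d (s.piecewise A B) := by
  ext x y
  simp only [prodMat, of_apply, Pi.add_apply, Matrix.add_apply, Matrix.sum_apply, Fintype.prod_add]
  refine Finset.sum_congr rfl fun s _ => ?_
  rw [← Finset.prod_mul_prod_compl s]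
  congr 1 <;> refine Finset.prod_congr rfl fun k hk => ?_
  · rw [Finset.piecewise_eq_of_mem _ _ _ hk]
  · rw [Finset.piecewise_eq_of_notMem _ _ _ (Finset.mem_compl.mp hk)]

theorem prodMat_smul (c : Fin m → ℂ) (A : ∀ k, Matrix (Fin (d k)) (Fin (d k)) ℂ) :
    prodMat d (fun k => c k • A k) = (∏ k, c k) • prodMat d A := by
  ext x y
  simp [prodMat, Finset.prod_mul_distrib]

theorem prodMat_posSemidef {A : ∀ k, Matrix (Fin (d k)) (Fin (d k)) ℂ}
    (hA : ∀ k, (A k).PosSemidef) : (prodMat d A).PosSemidef := by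
  suffices h : ∀ s : Finset (Fin m), (of fun x y : ∀ k, Fin (d k) =>
      ∏ k ∈ s, A k (x k) (y k)).PosSemidef from h Finset.univ
  intro s
  induction s using Finset.induction_on with
  | empty =>
    convert! posSemidef_vecMulVec_self_star (1 : (∀ k, Fin (d k)) → ℂ) using 1
    ext x y
    simp [vecMulVec_apply]
  | insert k s hk ih =>
    convert! ((hA k).submatrix fun x : ∀ k, Fin (d k) => x k).hadamard ih using 1
    ext x y
    simp [Finset.prod_insert hk]

namespace IsSep

variable {E F : Matrix (∀ k, Fin (d k)) (∀ k, Fin (d k)) ℂ}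

theorem zero : IsSep (0 : Matrix (∀ k, Fin (d k)) (∀ k, Fin (d k)) ℂ) :=
  ⟨0, Fin.elim0, Fin.elim0, fun l => l.elim0, fun l => l.elim0, by simp⟩

theorem add (hE : IsSep E) (hF : IsSep F) : IsSep (E + F) := by
  obtain ⟨L, p, σ, hp, hσ, rfl⟩ := hE
  obtain ⟨L', p', σ', hp', hσ', rfl⟩ := hF
  refine ⟨L + L', Fin.append p p', Fin.append σ σ', fun l => ?_, fun l => ?_, ?_⟩
  · induction l using Fin.addCases <;> simp [hp, hp']
  · induction l using Fin.addCases <;> simp [hσ, hσ']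
  · simp [Fin.sum_univ_add]

theorem sum {α : Type*} (s : Finset α) (f : α → Matrix (∀ k, Fin (d k)) (∀ k, Fin (d k)) ℂ)
    (hf : ∀ a ∈ s, IsSep (f a)) : IsSep (∑ a ∈ s, f a) :=
  Finset.sum_induction f IsSep (fun _ _ => add) zero hf

theorem posSemidef_s13 (hE : IsSep E) : E.PosSemidef := by
  obtain ⟨L, p, σ, hp, hσ, rfl⟩ := hE
  refine posSemidef_sum _ fun l _ => (prodMat_posSemidef fun k => (hσ l k).1).smul ?_
  exact_mod_cast hp l

theorem prodMat_of_posSemidef {A : ∀ k, Matrix (Fin (d k)) (Fin (d k)) ℂ}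
    (hA : ∀ k, (A k).PosSemidef) : IsSep (prodMat d A) := by
  by_cases h0 : ∃ k, (A k).trace = 0
  · obtain ⟨k, hk⟩ := h0
    rw [(hA k).trace_eq_zero_iff] at hk
    convert! zero using 1
    ext x y
    exact Finset.prod_eq_zero (Finset.mem_univ k) (by simp [hk])
  push Not at h0
  have hpos (k : Fin m) : 0 < (A k).trace.re :=
    (Complex.lt_def.mp (lt_of_le_of_ne (hA k).trace_nonneg (h0 k).symm)).1
  have hcast (k : Fin m) : ((A k).trace.re : ℂ) = (A k).trace :=
    Complex.ext rfl (Complex.le_def.mp (hA k).trace_nonneg).2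
  refine ⟨1, fun _ => ∏ k, (A k).trace.re,
    fun _ k => (((A k).trace.re⁻¹ : ℝ) : ℂ) • A k,
    fun _ => Finset.prod_nonneg fun k _ => (hpos k).le, fun _ k => ⟨(hA k).smul ?_, ?_⟩, ?_⟩
  · exact_mod_cast (inv_pos.mpr (hpos k)).le
  · rw [trace_smul, smul_eq_mul, Complex.ofReal_inv, hcast, inv_mul_cancel₀ (h0 k)]
  · rw [Fin.sum_univ_one, prodMat_smul, smul_smul, Complex.ofReal_prod, ← Finset.prod_mul_distrib]
    have h1 (k : Fin m) : ((A k).trace.re : ℂ) * (((A k).trace.re⁻¹ : ℝ) : ℂ) = 1 := by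
      rw [Complex.ofReal_inv, hcast, mul_inv_cancel₀ (h0 k)]
    simp only [h1, Finset.prod_const_one, one_smul]

theorem one_sub_prodMat {σ : ∀ k, Matrix (Fin (d k)) (Fin (d k)) ℂ} (hσ : ∀ k, IsState (σ k)) :
    IsSep (1 - prodMat d σ) := by
  have h : 1 = ∑ s : Finset (Fin m), prodMat d (s.piecewise σ fun k => 1 - σ k) := by
    rw [← prodMat_add, ← prodMat_one]
    congr 1
    ext1 k
    simp
  rw [h, ← Finset.sum_erase_add _ _ (Finset.mem_univ Finset.univ), Finset.piecewise_univ,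
    add_sub_cancel_right]
  refine sum _ _ fun s _ => prodMat_of_posSemidef fun k => ?_
  by_cases hk : k ∈ s
  · rw [Finset.piecewise_eq_of_mem _ _ _ hk]
    exact (hσ k).1
  · rw [Finset.piecewise_eq_of_notMem _ _ _ hk]
    exact (hσ k).1.one_sub (hσ k).2

end IsSep

theorem IsBlockPos.of_isState {E : Matrix (∀ k, Fin (d k)) (∀ k, Fin (d k)) ℂ}
    (hE : E.IsHermitian)
    (h : ∀ σ : ∀ k, Matrix (Fin (d k)) (Fin (d k)) ℂ, (∀ k, IsState (σ k)) →
      0 ≤ (E * prodMat d σ).trace.re) : IsBlockPos E := by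
  refine ⟨hE, ?_⟩
  rintro F ⟨L, p, σ, hp, hσ, rfl⟩
  rw [Finset.mul_sum, trace_sum]
  refine Finset.sum_nonneg fun l _ => ?_
  rw [Matrix.mul_smul, trace_smul, smul_eq_mul]
  refine mul_nonneg (by exact_mod_cast hp l) (Complex.le_def.mpr ⟨h _ (hσ l), ?_⟩)
  exact (hE.im_trace_mul (prodMat_posSemidef fun k => (hσ l k).1).1).symm

end Separable

section Discrimination

variable {ι : Type*} [DecidableEq ι] {n : ℕ}

/-- The measurement guessing `i` with effect `F`, and `j` otherwise. -/
def twoOutcome (i j : Fin n) (F : Matrix ι ι ℂ) : Fin (n + 1) → Matrix ι ι ℂ :=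
  Fin.cons 0 (Pi.single i F + Pi.single j (1 - F))

theorem twoOutcome_sum (i j : Fin n) (F : Matrix ι ι ℂ) : ∑ k, twoOutcome i j F k = 1 := by
  simp [twoOutcome, Fin.sum_univ_succ, Finset.sum_add_distrib]

theorem twoOutcome_induction {P : Matrix ι ι ℂ → Prop} (h0 : P 0)
    (hadd : ∀ A B, P A → P B → P (A + B)) {i j : Fin n} {F : Matrix ι ι ℂ}
    (hF : P F) (hF' : P (1 - F)) (k : Fin (n + 1)) : P (twoOutcome i j F k) := by
  refine Fin.cases h0 (fun k => ?_) k
  refine hadd _ _ ?_ ?_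
  · by_cases h : k = i
    · subst h; simpa using hF
    · simpa [h] using h0
  · by_cases h : k = j
    · subst h; simpa using hF'
    · simpa [h] using h0

variable [Fintype ι]

theorem trace_sub_mul_re (a b : ℝ) (A B F : Matrix ι ι ℂ) :
    (((a : ℂ) • A - (b : ℂ) • B) * F).trace.re = a * (A * F).trace.re - b * (B * F).trace.re := by
  simp [Matrix.sub_mul, trace_sub]

theorem twoOutcome_guess (η : Fin n → ℝ) {ρ : Fin n → Matrix ι ι ℂ} {i j : Fin n}
    (hρ : (ρ j).trace = 1) (F : Matrix ι ι ℂ) :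
    ∑ k, η k * (ρ k * twoOutcome i j F k.succ).trace.re =
      η j - (((η j : ℂ) • ρ j - (η i : ℂ) • ρ i) * F).trace.re := by
  have hs (l : Fin n) (G : Matrix ι ι ℂ) :
      ∑ k, η k * (ρ k * Pi.single (M := fun _ => Matrix ι ι ℂ) l G k).trace.re =
        η l * (ρ l * G).trace.re := by
    rw [Fintype.sum_eq_single l fun k hk => by simp [hk], Pi.single_eq_same]
  simp only [twoOutcome, Fin.cons_succ, Pi.add_apply, trace_add, Complex.add_re,
    mul_add, Finset.sum_add_distrib, hs, trace_sub_mul_re, Matrix.mul_sub, Matrix.mul_one,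
    trace_sub, Complex.sub_re, hρ, Complex.one_re]
  ring

theorem guess_le {η : Fin n → ℝ} {ρ : Fin n → Matrix ι ι ℂ} {j : Fin n}
    (hη : 0 ≤ η j) (hρ : IsState (ρ j)) {M : Fin (n + 1) → Matrix ι ι ℂ}
    (hM0 : (M 0).PosSemidef) (hM : ∑ i, M i = 1)
    (h : ∀ i, 0 ≤ (((η j : ℂ) • ρ j - (η i : ℂ) • ρ i) * M i.succ).trace.re) :
    ∑ i, η i * (ρ i * M i.succ).trace.re ≤ η j := by
  have hsum : (ρ j * M 0).trace.re + ∑ i : Fin n, (ρ j * M i.succ).trace.re = 1 := by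
    have h1 : (ρ j * ∑ i, M i).trace.re = 1 := by rw [hM, Matrix.mul_one, hρ.2, Complex.one_re]
    rwa [Fin.sum_univ_succ, Matrix.mul_add, trace_add, Complex.add_re, Finset.mul_sum, trace_sum,
      Complex.re_sum] at h1
  calc ∑ i, η i * (ρ i * M i.succ).trace.re
      ≤ ∑ i : Fin n, η j * (ρ j * M i.succ).trace.re := Finset.sum_le_sum fun i _ => by
        have := h i
        rw [trace_sub_mul_re] at this
        linarith
    _ = η j * (1 - (ρ j * M 0).trace.re) := by rw [← Finset.mul_sum, ← hsum]; ring
    _ ≤ η j := mul_le_of_le_one_right hη <| by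
        linarith [(Complex.le_def.mp (hρ.1.trace_mul_nonneg hM0)).1, Complex.zero_re]

end Discrimination


/-- Proposition 1: `p_SEP = η j < p_G` iff every `η j • ρ j - η i • ρ i`
is block positive and at least one of them is an entanglement witness. -/
theorem pSEP_eq_prior_lt_pG_iff_EW
    {m : ℕ} (hm : 2 ≤ m) {d : Fin m → ℕ} (hd : ∀ k, 0 < d k) {n : ℕ}
    (η : Fin n → ℝ) (ρ : Fin n → Matrix (∀ k, Fin (d k)) (∀ k, Fin (d k)) ℂ)
    (hηpos : ∀ i, 0 < η i) (hηsum : ∑ i, η i = 1) (hρ : ∀ i, IsState (ρ i))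
    (j : Fin n) (g : ℝ)
    (hG : IsGreatest {x : ℝ |
        ∃ M : Fin (n + 1) → Matrix (∀ k, Fin (d k)) (∀ k, Fin (d k)) ℂ,
          (∀ i, (M i).PosSemidef) ∧ (∑ i, M i = 1) ∧
          x = ∑ i : Fin n, η i * ((ρ i * M i.succ).trace.re)} g) :
    (IsGreatest {x : ℝ |
        ∃ M : Fin (n + 1) → Matrix (∀ k, Fin (d k)) (∀ k, Fin (d k)) ℂ,
          (∀ i, IsSep (M i)) ∧ (∑ i, M i = 1) ∧
          x = ∑ i : Fin n, η i * ((ρ i * M i.succ).trace.re)} (η j) ∧ η j < g) ↔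
      ((∀ i, IsBlockPos ((η j : ℂ) • ρ j - (η i : ℂ) • ρ i)) ∧
        ∃ i, IsBlockPos ((η j : ℂ) • ρ j - (η i : ℂ) • ρ i) ∧
          ¬ ((η j : ℂ) • ρ j - (η i : ℂ) • ρ i).PosSemidef) := by
  have hW (i : Fin n) : ((η j : ℂ) • ρ j - (η i : ℂ) • ρ i).IsHermitian := by
    have hs (k : Fin n) : ((η k : ℂ) • ρ k).IsHermitian :=
      ((hρ k).1.smul (by exact_mod_cast (hηpos k).le)).1
    exact (hs j).sub (hs i)
  constructor
  · rintro ⟨hS, hlt⟩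
    have hBP (i : Fin n) : IsBlockPos ((η j : ℂ) • ρ j - (η i : ℂ) • ρ i) := by
      refine .of_isState (hW i) fun σ hσ => ?_
      have hle := hS.2 ⟨twoOutcome i j (prodMat d σ),
        twoOutcome_induction .zero (fun _ _ => .add)
          (.prodMat_of_posSemidef fun k => (hσ k).1) (.one_sub_prodMat hσ),
        twoOutcome_sum i j _, rfl⟩
      rw [twoOutcome_guess η (hρ j).2] at hle
      linarith
    refine ⟨hBP, ?_⟩
    by_contra! hpsd
    obtain ⟨M, hM, hM1, rfl⟩ := hG.1
    exact hlt.not_ge <| guess_le (hηpos j).le (hρ j) (hM 0) hM1 fun i =>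
      (Complex.le_def.mp ((hpsd i (hBP i)).trace_mul_nonneg (hM i.succ))).1
  · rintro ⟨hBP, i, -, hi⟩
    refine ⟨⟨⟨twoOutcome j j 0, twoOutcome_induction .zero (fun _ _ => .add) .zero ?_,
      twoOutcome_sum j j 0, ?_⟩, ?_⟩, ?_⟩
    · rw [sub_zero, ← prodMat_one]
      exact .prodMat_of_posSemidef fun _ => .one
    · rw [twoOutcome_guess η (hρ j).2]
      simp
    · rintro _ ⟨M, hM, hM1, rfl⟩
      exact guess_le (hηpos j).le (hρ j) (hM 0).posSemidef_s13 hM1 fun i =>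
        (Complex.le_def.mp ((hBP i).2 _ (hM i.succ))).1
    · obtain ⟨P, hP, hneg⟩ := exists_isState_trace_mul_neg (hW i) hi
      have hle := hG.2 ⟨twoOutcome i j P,
        twoOutcome_induction .zero (fun _ _ => .add) hP.1 (hP.1.one_sub hP.2),
        twoOutcome_sum i j P, rfl⟩
      rw [twoOutcome_guess η (hρ j).2] at hle
      linarith
end
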